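/- Let ξ = exp(iπ/6) and τ = √3/4. Define seven four-qutrit vectors, each with amplitude 3^{−k/2}·ω^{Q(w)} at the indicated points (exponents mod 3, amplitude 0 elsewhere): σ₀ (k=3) at points (w₀,2,w₁,w₂) with Q₀ = 2w₀ + w₀² + w₁ + 2w₁² + 2w₂ + w₂²; σ₁ (k=4) at all y ∈ 𝔽₃⁴ with Q₁ = 2y₀ + y₀² + 2y₁ + y₁² + y₂ + 2y₂² + y₃ + 2y₃²; σ₂ (k=2) at points (2,w₀,w₁,2) with Q₂ = w₀ + 2w₀² + w₁ + 2w₁²; σ₃ (k=2) at points (w₀,w₁,2,2) with Q₃ = 2w₀ + w₀² + w₁ + 2w₁²; σ₄ (k=3) at points (2,w₀,w₁,w₂) with Q₄ = 2w₀ + w₀² + 2w₁ + w₁² + w₂ + 2w₂²; σ₅ (k=2) at points (w₀,2,2,w₁) with Q₅ = w₀ + 2w₀² + 2w₁ + w₁²; σ₆ (k=4) at all y ∈ 𝔽₃⁴ with Q₆ = 0. Then |ℕ⟩^{⊗4} = τω·σ₀ + τξ·σ₁ + τξ·σ₂ + τξ·σ₃ + τω·σ₄ + τξ·σ₅ + (ω²/4)·σ₆.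 All seven σⱼ are canonical 4-qutrit stabilizer states, so χ(|ℕ⟩^{⊗4}) ≤ 7. -/

import Mathlib

open Complex
open scoped BigOperators

noncomputable section

/-- An `m`-qutrit state is a vector of amplitudes indexed by `Fin m → ZMod 3`. -/
abbrev QS (m : ℕ) := (Fin m → ZMod 3) → ℂ

/-- The primitive cube root of unity `ω = exp(2πi/3)`. -/
def ω : ℂ := Complex.exp (2 * Real.pi * Complex.I / 3)

/-- `ω` raised to an exponent in `ZMod 3`. -/
def ωp (a : ZMod 3) : ℂ := ω ^ a.val

/-- A polynomial `Q : 𝔽₃^k → 𝔽₃` of degree at most 2. -/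
def IsDeg2 {k : ℕ} (Q : (Fin k → ZMod 3) → ZMod 3) : Prop :=
  ∃ (A : Fin k → Fin k → ZMod 3) (b : Fin k → ZMod 3) (c : ZMod 3),
    ∀ y, Q y = (∑ i, ∑ j, A i j * y i * y j) + (∑ i, b i * y i) + c

/-- `σ` is a canonical `m`-qutrit stabilizer state:
`σ = 3^{-k/2} ∑_{y ∈ 𝔽₃^k} ω^{Q(y)} |x₀ + W y⟩` with `W` injective linear and `deg Q ≤ 2`. -/
def IsStab {m : ℕ} (σ : QS m) : Prop :=
  ∃ k : ℕ, k ≤ m ∧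
    ∃ (x₀ : Fin m → ZMod 3)
      (W : (Fin k → ZMod 3) →ₗ[ZMod 3] (Fin m → ZMod 3))
      (Q : (Fin k → ZMod 3) → ZMod 3),
      Function.Injective W ∧ IsDeg2 Q ∧
      σ = fun x => ((Real.sqrt (3 ^ k) : ℝ) : ℂ)⁻¹ *
        ∑ y : Fin k → ZMod 3, if x = x₀ + W y then ωp (Q y) else 0

/-- The stabilizer rank: the least `r` such that `ψ` is a ℂ-linear combination of `r`
canonical stabilizer states. -/
def stabRank {m : ℕ} (ψ : QS m) : ℕ :=
  sInf {r : ℕ | ∃ (c : Fin r → ℂ) (σ : Fin r → QS m),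
    (∀ i, IsStab (σ i)) ∧ ψ = ∑ i, c i • σ i}

/-- The `m`-fold tensor power of a single-qutrit state. -/
def tpow (ψ : ZMod 3 → ℂ) (m : ℕ) : QS m := fun x => ∏ i, ψ (x i)

/-- The Norrell state `|ℕ⟩ = (|0⟩ + |1⟩ - 2|2⟩)/√6`. -/
def Nor : ZMod 3 → ℂ := fun j =>
  ((if j = 0 then 1 else 0) + (if j = 1 then 1 else 0) - 2 * (if j = 2 then 1 else 0))
    / (Real.sqrt 6 : ℂ)

/-- `ξ = exp(iπ/6)`, a primitive 12th root of unity. -/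
def ξ : ℂ := Complex.exp (Real.pi * Complex.I / 6)

/-- `τ = √3/4`. -/
def τ : ℝ := Real.sqrt 3 / 4

/-- `σ₀` (k = 3): supported on `(w₀, 2, w₁, w₂)` with
`Q₀ = 2w₀ + w₀² + w₁ + 2w₁² + 2w₂ + w₂²`. -/
def σP0 : QS 4 := fun x =>
  if x 1 = 2 then ((Real.sqrt (3 ^ 3) : ℝ) : ℂ)⁻¹ *
    ωp (2 * x 0 + x 0 ^ 2 + x 2 + 2 * x 2 ^ 2 + 2 * x 3 + x 3 ^ 2) else 0

/-- `σ₁` (k = 4): full support with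
`Q₁ = 2y₀ + y₀² + 2y₁ + y₁² + y₂ + 2y₂² + y₃ + 2y₃²`. -/
def σP1 : QS 4 := fun y =>
  ((Real.sqrt (3 ^ 4) : ℝ) : ℂ)⁻¹ *
    ωp (2 * y 0 + y 0 ^ 2 + 2 * y 1 + y 1 ^ 2 + y 2 + 2 * y 2 ^ 2 + y 3 + 2 * y 3 ^ 2)

/-- `σ₂` (k = 2): supported on `(2, w₀, w₁, 2)` with `Q₂ = w₀ + 2w₀² + w₁ + 2w₁²`. -/
def σP2 : QS 4 := fun x =>
  if x 0 = 2 ∧ x 3 = 2 then (1 / 3 : ℂ) *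
    ωp (x 1 + 2 * x 1 ^ 2 + x 2 + 2 * x 2 ^ 2) else 0

/-- `σ₃` (k = 2): supported on `(w₀, w₁, 2, 2)` with `Q₃ = 2w₀ + w₀² + w₁ + 2w₁²`. -/
def σP3 : QS 4 := fun x =>
  if x 2 = 2 ∧ x 3 = 2 then (1 / 3 : ℂ) *
    ωp (2 * x 0 + x 0 ^ 2 + x 1 + 2 * x 1 ^ 2) else 0

/-- `σ₄` (k = 3): supported on `(2, w₀, w₁, w₂)` with
`Q₄ = 2w₀ + w₀² + 2w₁ + w₁² + w₂ + 2w₂²`. -/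
def σP4 : QS 4 := fun x =>
  if x 0 = 2 then ((Real.sqrt (3 ^ 3) : ℝ) : ℂ)⁻¹ *
    ωp (2 * x 1 + x 1 ^ 2 + 2 * x 2 + x 2 ^ 2 + x 3 + 2 * x 3 ^ 2) else 0

/-- `σ₅` (k = 2): supported on `(w₀, 2, 2, w₁)` with `Q₅ = w₀ + 2w₀² + 2w₁ + w₁²`. -/
def σP5 : QS 4 := fun x =>
  if x 1 = 2 ∧ x 2 = 2 then (1 / 3 : ℂ) *
    ωp (x 0 + 2 * x 0 ^ 2 + 2 * x 3 + x 3 ^ 2) else 0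

/-- `σ₆` (k = 4): `|+⟩^{⊗4}`, i.e. `Q₆ = 0` with full support. -/
def σP6 : QS 4 := fun _ => ((Real.sqrt (3 ^ 4) : ℝ) : ℂ)⁻¹

theorem isDeg2_diagonal {k : ℕ} (b d : Fin k → ZMod 3) :
    IsDeg2 fun y => ∑ i, (b i * y i + d i * y i ^ 2) := by
  refine ⟨Matrix.diagonal d, b, 0, fun y => ?_⟩
  simp only [Matrix.diagonal_apply, ite_mul, zero_mul, Finset.sum_ite_eq, Finset.mem_univ,
    if_true, add_zero, ← Finset.sum_add_distrib]
  exact Finset.sum_congr rfl fun i _ => by ring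

/-- A quadratic phase on the coordinates selected by `f`, the others being frozen to `a`, is a
canonical stabilizer state. -/
theorem isStab_of_coordinates {k m : ℕ} {f : Fin k → Fin m} (hf : Function.Injective f)
    (a : Fin m → ZMod 3) {Q : (Fin k → ZMod 3) → ZMod 3} (hQ : IsDeg2 Q) {σ : QS m}
    (hσ : ∀ x, (∀ i ∉ Set.range f, x i = a i) →
      σ x = ((Real.sqrt (3 ^ k) : ℝ) : ℂ)⁻¹ * ωp (Q (x ∘ f)))
    (hσ' : ∀ x, ¬ (∀ i ∉ Set.range f, x i = a i) → σ x = 0) : IsStab σ := by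
  classical
  have hW : ∀ y i, Function.ExtendByZero.linearMap (ZMod 3) f y (f i) = y i := fun y i =>
    hf.extend_apply y 0 i
  have hW' : ∀ y, ∀ i ∉ Set.range f, Function.ExtendByZero.linearMap (ZMod 3) f y i = 0 :=
    fun y i hi => Function.extend_apply' y (0 : Fin m → ZMod 3) i hi
  have key : ∀ x y, x = (fun i => if i ∈ Set.range f then 0 else a i) +
      Function.ExtendByZero.linearMap (ZMod 3) f y ↔
      (∀ i ∉ Set.range f, x i = a i) ∧ y = x ∘ f := by
    intro x y
    constructor
    · rintro rfl
      refine ⟨fun i hi => ?_, funext fun i => ?_⟩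
      · rw [Pi.add_apply, hW' y i hi, if_neg hi, add_zero]
      · rw [Function.comp_apply, Pi.add_apply, hW, if_pos (Set.mem_range_self i), zero_add]
    · rintro ⟨hx, rfl⟩
      funext i
      by_cases hi : i ∈ Set.range f
      · obtain ⟨j, rfl⟩ := hi
        rw [Pi.add_apply, hW, if_pos (Set.mem_range_self j), zero_add, Function.comp_apply]
      · rw [Pi.add_apply, hW' _ i hi, if_neg hi, add_zero, hx i hi]
  refine ⟨k, by simpa using Fintype.card_le_of_injective f hf,
    fun i => if i ∈ Set.range f then 0 else a i,
    Function.ExtendByZero.linearMap (ZMod 3) f, Q, fun y z h => funext fun i => ?_, hQ,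
    funext fun x => ?_⟩
  · rw [← hW y, h, hW]
  · simp only [key]
    by_cases hx : ∀ i ∉ Set.range f, x i = a i
    · simp only [hσ x hx, and_iff_right hx, Finset.sum_ite_eq', Finset.mem_univ, if_true]
    · simp only [hx, hσ' x hx, false_and, if_false, Finset.sum_const_zero, mul_zero]

theorem stabRank_le {m r : ℕ} {ψ : QS m} (c : Fin r → ℂ) (σ : Fin r → QS m)
    (hσ : ∀ i, IsStab (σ i)) (hψ : ψ = ∑ i, c i • σ i) : stabRank ψ ≤ r :=
  Nat.sInf_le ⟨c, σ, hσ, hψ⟩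

theorem isStab_σP0 : IsStab σP0 := by
  refine isStab_of_coordinates (f := ![0, 2, 3]) (by decide) (fun _ => 2)
    (isDeg2_diagonal ![2, 1, 2] ![1, 2, 1]) (fun x hx => ?_) fun x hx => ?_ <;>
  simp [Fin.forall_fin_succ] at hx <;>
  simp [σP0, hx, Fin.sum_univ_succ, add_assoc]

theorem isStab_σP1 : IsStab σP1 := by
  refine isStab_of_coordinates (f := id) (by decide) (fun _ => 2)
    (isDeg2_diagonal ![2, 2, 1, 1] ![1, 1, 2, 2]) (fun x _ => ?_) fun x hx => ?_
  · simp [σP1, Fin.sum_univ_succ, add_assoc]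
  · simp at hx

theorem isStab_σP2 : IsStab σP2 := by
  refine isStab_of_coordinates (f := ![1, 2]) (by decide) (fun _ => 2)
    (isDeg2_diagonal ![1, 1] ![2, 2]) (fun x hx => ?_) fun x hx => ?_ <;>
  simp [Fin.forall_fin_succ] at hx <;>
  simp +contextual [σP2, hx, Fin.sum_univ_succ, add_assoc]

theorem isStab_σP3 : IsStab σP3 := by
  refine isStab_of_coordinates (f := ![0, 1]) (by decide) (fun _ => 2)
    (isDeg2_diagonal ![2, 1] ![1, 2]) (fun x hx => ?_) fun x hx => ?_ <;>
  simp [Fin.forall_fin_succ] at hx <;>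
  simp +contextual [σP3, hx, Fin.sum_univ_succ, add_assoc]

theorem isStab_σP4 : IsStab σP4 := by
  refine isStab_of_coordinates (f := ![1, 2, 3]) (by decide) (fun _ => 2)
    (isDeg2_diagonal ![2, 2, 1] ![1, 1, 2]) (fun x hx => ?_) fun x hx => ?_ <;>
  simp [Fin.forall_fin_succ] at hx <;>
  simp [σP4, hx, Fin.sum_univ_succ, add_assoc]

theorem isStab_σP5 : IsStab σP5 := by
  refine isStab_of_coordinates (f := ![0, 3]) (by decide) (fun _ => 2)
    (isDeg2_diagonal ![1, 2] ![2, 1]) (fun x hx => ?_) fun x hx => ?_ <;>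
  simp [Fin.forall_fin_succ] at hx <;>
  simp +contextual [σP5, hx, Fin.sum_univ_succ, add_assoc]

theorem isStab_σP6 : IsStab σP6 := by
  refine isStab_of_coordinates (f := id) (by decide) (fun _ => 2)
    (isDeg2_diagonal 0 0) (fun x _ => ?_) fun x hx => ?_
  · simp [σP6, ωp]
  · simp at hx

theorem ω_eq : ω = (-1 + (Real.sqrt 3 : ℂ) * I) / 2 := by
  have h : (2 * Real.pi * I / 3 : ℂ) = ((Real.pi - Real.pi / 3 : ℝ) : ℂ) * I := by
    push_cast; ring
  rw [ω, h, exp_mul_I, ← ofReal_cos, ← ofReal_sin, Real.cos_pi_sub, Real.sin_pi_sub,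
    Real.cos_pi_div_three, Real.sin_pi_div_three]
  push_cast
  ring

theorem ξ_eq : ξ = ((Real.sqrt 3 : ℂ) + I) / 2 := by
  have h : (Real.pi * I / 6 : ℂ) = ((Real.pi / 6 : ℝ) : ℂ) * I := by
    push_cast; ring
  rw [ξ, h, exp_mul_I, ← ofReal_cos, ← ofReal_sin, Real.cos_pi_div_six, Real.sin_pi_div_six]
  push_cast
  ring

theorem sqrt_three_sq : (Real.sqrt 3 : ℂ) ^ 2 = 3 := by
  rw [← ofReal_pow, Real.sq_sqrt (by norm_num)]
  norm_num

theorem ω_sq : ω ^ 2 = -1 - ω := by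
  rw [ω_eq]
  linear_combination (I ^ 2 / 4) * sqrt_three_sq + (3 / 4) * I_sq

theorem τ_mul_ξ : (τ : ℂ) * ξ = (2 + ω) / 4 := by
  rw [ξ_eq, ω_eq, τ]
  push_cast
  linear_combination (1 / 8) * sqrt_three_sq

theorem τ_mul_inv_sqrt : (τ : ℂ) * ((Real.sqrt (3 ^ 3) : ℝ) : ℂ)⁻¹ = 1 / 12 := by
  have h : Real.sqrt (3 ^ 3) = 3 * Real.sqrt 3 := by
    rw [show (3 : ℝ) ^ 3 = 3 ^ 2 * 3 by norm_num, Real.sqrt_mul (by norm_num),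
      Real.sqrt_sq (by norm_num)]
  rw [h, τ, ← ofReal_inv, ← ofReal_mul]
  have h0 : Real.sqrt 3 ≠ 0 := by positivity
  have h1 : Real.sqrt 3 / 4 * (3 * Real.sqrt 3)⁻¹ = 1 / 12 := by field_simp; norm_num
  rw [h1]
  norm_num

theorem inv_sqrt_three_pow_four : ((Real.sqrt (3 ^ 4) : ℝ) : ℂ)⁻¹ = 1 / 9 := by
  rw [show (3 : ℝ) ^ 4 = 9 ^ 2 by norm_num, Real.sqrt_sq (by norm_num)]
  norm_num

theorem two_mul_add_sq (a : ZMod 3) : 2 * a + a ^ 2 = if a = 2 then 2 else 0 := by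
  revert a; decide

theorem add_two_mul_sq (a : ZMod 3) : a + 2 * a ^ 2 = if a = 2 then 1 else 0 := by
  revert a; decide

theorem ωp_add (a b : ZMod 3) : ωp (a + b) = ωp a * ωp b := by
  have h : ω ^ 3 = 1 := by linear_combination (ω - 1) * ω_sq
  rw [ωp, ωp, ωp, ZMod.val_add, ← pow_add, ← pow_eq_pow_mod _ h]

/-- The phase `ω^(2a + a²)` depends only on whether `a = 2`. -/
theorem ωp_two_mul_add_sq (a : ZMod 3) :
    ωp (2 * a) * ωp (a ^ 2) = if a = 2 then -1 - ω else 1 := by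
  rw [← ωp_add, two_mul_add_sq]
  split_ifs
  · exact ω_sq
  · exact pow_zero ω

/-- The phase `ω^(a + 2a²)` depends only on whether `a = 2`. -/
theorem ωp_add_two_mul_sq (a : ZMod 3) :
    ωp a * ωp (2 * a ^ 2) = if a = 2 then ω else 1 := by
  rw [← ωp_add, add_two_mul_sq]
  split_ifs
  · exact pow_one ω
  · exact pow_zero ω

theorem Nor_eq (a : ZMod 3) : Nor a = (if a = 2 then -2 else 1) / (Real.sqrt 6 : ℂ) := by
  have h : ∀ a : ZMod 3, a = 0 ∨ a = 1 ∨ a = 2 := by decide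
  have h02 : (0 : ZMod 3) ≠ 2 := by decide
  have h12 : (1 : ZMod 3) ≠ 2 := by decide
  rcases h a with rfl | rfl | rfl <;> simp [Nor, h02, h12, h02.symm, h12.symm]

theorem tpow_Nor_four (x : Fin 4 → ZMod 3) :
    tpow Nor 4 x = (if x 0 = 2 then -2 else 1) * (if x 1 = 2 then -2 else 1) *
      (if x 2 = 2 then -2 else 1) * (if x 3 = 2 then -2 else 1) / 36 := by
  have h : (Real.sqrt 6 : ℂ) ^ 2 = 6 := by
    rw [← ofReal_pow, Real.sq_sqrt (by norm_num)]
    norm_num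
  have h4 : (Real.sqrt 6 : ℂ) * Real.sqrt 6 * Real.sqrt 6 * Real.sqrt 6 = 36 := by
    linear_combination ((Real.sqrt 6 : ℂ) ^ 2 + 6) * h
  simp only [tpow, Fin.prod_univ_four, Nor_eq, div_mul_div_comm, h4]

theorem tpow_Nor_four_eq :
    tpow Nor 4 =
      ((τ : ℂ) * ω) • σP0 + ((τ : ℂ) * ξ) • σP1 + ((τ : ℂ) * ξ) • σP2 +
      ((τ : ℂ) * ξ) • σP3 + ((τ : ℂ) * ω) • σP4 + ((τ : ℂ) * ξ) • σP5 +
      (ω ^ 2 / 4) • σP6 := by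
  funext x
  have hf (a : ZMod 3) (z : ℂ) := congrArg (z * ·) (ωp_two_mul_add_sq a)
  have hg (a : ZMod 3) (z : ℂ) := congrArg (z * ·) (ωp_add_two_mul_sq a)
  have hτ (z : ℂ) : (τ : ℂ) * ω * (((Real.sqrt (3 ^ 3) : ℝ) : ℂ)⁻¹ * z) = ω / 12 * z := by
    linear_combination (ω * z) * τ_mul_inv_sqrt
  simp only [← mul_assoc] at hf hg
  simp only [tpow_Nor_four, Pi.add_apply, Pi.smul_apply, smul_eq_mul, σP0, σP1, σP2, σP3, σP4,
    σP5, σP6, mul_ite, mul_zero, hτ, τ_mul_ξ, inv_sqrt_three_pow_four, ω_sq, ωp_add, ← mul_assoc,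
    hf, hg, ωp_two_mul_add_sq, ωp_add_two_mul_sq]
  have h := ω_sq
  by_cases h0 : x 0 = 2 <;> by_cases h1 : x 1 = 2 <;> by_cases h2 : x 2 = 2 <;>
    by_cases h3 : x 3 = 2 <;>
    simp only [h0, h1, h2, h3, if_true, if_false, and_true, and_false, and_self] <;> grind

/-- `|ℕ⟩^{⊗4} = τω·σ₀ + τξ·σ₁ + τξ·σ₂ + τξ·σ₃ + τω·σ₄ + τξ·σ₅ + (ω²/4)·σ₆`;
all seven are canonical 4-qutrit stabilizer states, so `χ(|ℕ⟩^{⊗4}) ≤ 7`. -/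
theorem norrell_m4_decomposition :
    tpow Nor 4 =
      ((τ : ℂ) * ω) • σP0 + ((τ : ℂ) * ξ) • σP1 + ((τ : ℂ) * ξ) • σP2 +
      ((τ : ℂ) * ξ) • σP3 + ((τ : ℂ) * ω) • σP4 + ((τ : ℂ) * ξ) • σP5 +
      (ω ^ 2 / 4) • σP6 ∧
    IsStab σP0 ∧ IsStab σP1 ∧ IsStab σP2 ∧ IsStab σP3 ∧ IsStab σP4 ∧
    IsStab σP5 ∧ IsStab σP6 ∧
    stabRank (tpow Nor 4) ≤ 7 := by
  refine ⟨tpow_Nor_four_eq, isStab_σP0, isStab_σP1, isStab_σP2, isStab_σP3, isStab_σP4, isStab_σP5,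
    isStab_σP6, stabRank_le ![τ * ω, τ * ξ, τ * ξ, τ * ξ, τ * ω, τ * ξ, ω ^ 2 / 4]
      ![σP0, σP1, σP2, σP3, σP4, σP5, σP6] ?_ ?_⟩
  · simp [Fin.forall_fin_succ, isStab_σP0, isStab_σP1, isStab_σP2, isStab_σP3, isStab_σP4,
      isStab_σP5, isStab_σP6]
  · rw [tpow_Nor_four_eq]
    simp [Fin.sum_univ_succ, add_assoc]
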